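/- Let A₁, …, A_m ∈ Mₙ be linearly independent matrices such that AᵢAⱼᵀ and AᵢᵀAⱼ are symmetric for all i, j. Let P, Q ∈ Mₙ be orthogonal matrices such that each Dᵢ = PᵀAᵢQ is diagonal, say D_k has diagonal (d(k,1),…,d(k,n)). Suppose j₁, …, j_r ∈ {1,…,n} are pairwise nonequivalent indices (with components computed from the family (d(k,j))), each of whose components satisfies the *-Property, and such that every index whose component satisfies the *-Property is equivalent to some j_p. Then for any T ∈ Mₙ and any α₁, …, α_m ∈ ℝ, the matrix Σ_k α_k A_k is a best coapproximation to T out of span{A₁, …, A_m} (with respect to the operator norm) if and only if for every p ∈ {1,…,r}: Σ_k α_k d(k, j_p) ∈ W_{j_p}(PᵀTQ). -/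

import Mathlib

/-- The operator norm of an `n × n` real matrix, induced by the Euclidean norm on `ℝⁿ`. -/
noncomputable def opNorm {n : ℕ} (A : Matrix (Fin n) (Fin n) ℝ) : ℝ :=
  ‖LinearMap.toContinuousLinearMap (Matrix.toEuclideanLin A)‖

/-- The `i`-th component of the family of diagonals `a`. -/
def comp {m n : ℕ} (a : Fin m → Fin n → ℝ) (i : Fin n) : Fin m → ℝ := fun k => a k i

/-- The positively associated set of the `i`-th component. -/
def Pplus {m n : ℕ} (a : Fin m → Fin n → ℝ) (i : Fin n) : Set (Fin n) :=
  {j | comp a j = comp a i}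

/-- The negatively associated set of the `i`-th component. -/
def Pminus {m n : ℕ} (a : Fin m → Fin n → ℝ) (i : Fin n) : Set (Fin n) :=
  {j | comp a j = -comp a i}

/-- `Sᵢ = Pᵢ⁺ ∪ Pᵢ⁻`. -/
def Sset {m n : ℕ} (a : Fin m → Fin n → ℝ) (i : Fin n) : Set (Fin n) :=
  Pplus a i ∪ Pminus a i

/-- The `i`-th component satisfies the `*`-Property. -/
def StarProperty {m n : ℕ} (a : Fin m → Fin n → ℝ) (i : Fin n) : Prop :=
  ∃ β : Fin m → ℝ, (∑ k, β k * a k i) ≠ 0 ∧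
    ∀ j ∉ Sset a i, |∑ k, β k * a k j| < |∑ k, β k * a k i|

/-- Components `i` and `j` are equivalent if `v_j = ± vᵢ`. -/
def EquivComp {m n : ℕ} (a : Fin m → Fin n → ℝ) (i j : Fin n) : Prop :=
  comp a j = comp a i ∨ comp a j = -comp a i

-- The sign `ε_u`: `1` on `Pᵢ⁺`, `-1` on `Pᵢ⁻`, and `0` elsewhere.
open Classical in
noncomputable def eps {m n : ℕ} (a : Fin m → Fin n → ℝ) (i u : Fin n) : ℝ :=
  if u ∈ Pplus a i then 1 else if u ∈ Pminus a i then -1 else 0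

/-- `Wᵢ(T)`, the numerical range of the `*`-associated matrix of `T` corresponding to the
`i`-th component: values `Σ_{u,v} ε_u T_{uv} x_u x_v` over unit vectors `x` supported in `Sᵢ`. -/
def Wset {m n : ℕ} (a : Fin m → Fin n → ℝ) (i : Fin n)
    (T : Matrix (Fin n) (Fin n) ℝ) : Set ℝ :=
  {w : ℝ | ∃ x : EuclideanSpace ℝ (Fin n), ‖x‖ = 1 ∧ (∀ h ∉ Sset a i, x h = 0) ∧
    w = ∑ u, ∑ v, eps a i u * T u v * x u * x v}

open Matrix in
open scoped Matrix.Norms.L2Operator in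
theorem opNorm_eq_l2 {n : ℕ} (A : Matrix (Fin n) (Fin n) ℝ) : opNorm A = ‖A‖ := rfl

open Matrix in
open scoped Matrix.Norms.L2Operator in
theorem opNorm_diagonal {n : ℕ} (g : Fin n → ℝ) : opNorm (diagonal g) = ‖g‖ :=
  l2_opNorm_diagonal g

open Matrix in
open scoped Matrix.Norms.L2Operator in
theorem opNorm_transpose_mul_mul {n : ℕ} {P Q : Matrix (Fin n) (Fin n) ℝ}
    (hP₁ : Pᵀ * P = 1) (hP₂ : P * Pᵀ = 1) (hQ₁ : Qᵀ * Q = 1) (hQ₂ : Q * Qᵀ = 1)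
    (C : Matrix (Fin n) (Fin n) ℝ) : opNorm (Pᵀ * C * Q) = opNorm C := by
  have hP : Pᵀ ∈ unitary (Matrix (Fin n) (Fin n) ℝ) := by
    rw [Unitary.mem_iff]
    simpa [star_eq_conjTranspose] using ⟨hP₂, hP₁⟩
  have hQ : Q ∈ unitary (Matrix (Fin n) (Fin n) ℝ) := by
    rw [Unitary.mem_iff]
    simpa [star_eq_conjTranspose] using ⟨hQ₁, hQ₂⟩
  rw [opNorm_eq_l2, opNorm_eq_l2, CStarRing.norm_mul_mem_unitary _ hQ,
    CStarRing.norm_mem_unitary_mul _ hP]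

/-- A nonzero maximum of a linear functional (in absolute value) over the components
is attained at a component with the `*`-Property. -/
theorem exists_starProperty_abs_le {m n : ℕ} (a : Fin m → Fin n → ℝ) (γ : Fin m → ℝ)
    (l : Fin n) (hl : ∑ k, γ k * a k l ≠ 0) :
    ∃ i, StarProperty a i ∧ |∑ k, γ k * a k l| ≤ |∑ k, γ k * a k i| := by
  classical
  set w : Fin n → ℝ := fun j => ∑ k, γ k * a k j with hw
  set G : Fin n → Fin n → ℝ := fun i j => ∑ k, a k i * a k j with hG
  obtain ⟨i₀, -, hi₀⟩ := Finset.exists_max_image Finset.univ (fun j => |w j|) ⟨l, Finset.mem_univ l⟩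
  obtain ⟨i, hi, hmax⟩ := Finset.exists_max_image (Finset.univ.filter fun j => |w j| = |w i₀|)
    (fun j => G j j) ⟨i₀, by simp⟩
  have hi' : |w i| = |w i₀| := (Finset.mem_filter.1 hi).2
  have hle : ∀ j, |w j| ≤ |w i| := fun j => hi' ▸ hi₀ j (Finset.mem_univ j)
  have hpos : 0 < |w i| := (abs_pos.2 hl).trans_le (hle l)
  refine ⟨i, ?_, hle l⟩
  have hGnn : 0 ≤ G i i := Finset.sum_nonneg fun k _ => mul_self_nonneg _
  have hstrict : ∀ j ∉ Sset a i, |w j| = |w i| → |G i j| < G i i := by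
    intro j hj hjw
    have hjj : G j j ≤ G i i := hmax j (by simp [hjw, hi'])
    have key : ∀ s : ℝ, (∃ k, a k j - s * a k i ≠ 0) →
        0 < G j j - 2 * s * G i j + s ^ 2 * G i i := by
      rintro s ⟨k, hk⟩
      have : G j j - 2 * s * G i j + s ^ 2 * G i i = ∑ k, (a k j - s * a k i) ^ 2 := by
        simp only [hG, Finset.mul_sum, ← Finset.sum_sub_distrib, ← Finset.sum_add_distrib]
        exact Finset.sum_congr rfl fun _ _ => by ring
      rw [this]
      exact Finset.sum_pos' (fun _ _ => sq_nonneg _) ⟨k, Finset.mem_univ k, by positivity⟩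
    have h1 : ∃ k, a k j - 1 * a k i ≠ 0 := by
      by_contra! h
      exact hj (Or.inl (funext fun k => by simpa [comp, sub_eq_zero] using h k))
    have h2 : ∃ k, a k j - (-1) * a k i ≠ 0 := by
      by_contra! h
      refine hj (Or.inr (funext fun k => ?_))
      have := h k
      simp only [comp, Pi.neg_apply]
      linarith
    have := key 1 h1
    have := key (-1) h2
    rw [abs_lt]
    constructor <;> linarith
  have hev : ∀ j, ∀ᶠ t in nhdsWithin (0 : ℝ) (Set.Ioi 0), j ∉ Sset a i →
      |w j| + t * |w i| * |G i j| < |w i| + t * |w i| * G i i := by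
    intro j
    rcases (hle j).lt_or_eq with h | h
    · have hc : Filter.Tendsto (fun t : ℝ => |w i| + t * |w i| * G i i -
          (|w j| + t * |w i| * |G i j|)) (nhdsWithin (0 : ℝ) (Set.Ioi 0))
          (nhds (|w i| + 0 * |w i| * G i i - (|w j| + 0 * |w i| * |G i j|))) :=
        (Continuous.tendsto (by fun_prop) 0).mono_left nhdsWithin_le_nhds
      filter_upwards [hc.eventually (lt_mem_nhds (a := (0 : ℝ)) (by simpa using h))] with t ht _
      linarith
    · filter_upwards [self_mem_nhdsWithin] with t ht hj
      rw [h]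
      have := mul_lt_mul_of_pos_left (hstrict j hj h) (mul_pos (Set.mem_Ioi.1 ht) hpos)
      linarith
  obtain ⟨t, ht, htpos⟩ := ((Filter.eventually_all.2 hev).and self_mem_nhdsWithin).exists
  have htpos : 0 < t := htpos
  have hcomb : ∀ j, ∑ k, (γ k + t * w i * a k i) * a k j = w j + t * w i * G i j := by
    intro j
    simp only [hw, hG, add_mul, Finset.sum_add_distrib, Finset.mul_sum, mul_assoc]
  have habs : |w i + t * w i * G i i| = |w i| + t * |w i| * G i i := by
    rw [show w i + t * w i * G i i = w i * (1 + t * G i i) by ring, abs_mul,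
      abs_of_pos (a := 1 + t * G i i) (by positivity)]
    ring
  refine ⟨fun k => γ k + t * w i * a k i, ?_, fun j hj => ?_⟩
  · rw [hcomb, ← abs_pos, habs]
    positivity
  · rw [hcomb, hcomb, habs]
    refine lt_of_le_of_lt (abs_add_le _ _) ?_
    rw [abs_mul, abs_mul, abs_of_pos htpos]
    exact ht j hj

open scoped RealInnerProductSpace in
/-- If `‖D‖ ≤ 1 ≤ ‖D + s • M‖` for all positive `s`, then `D` attains norm one at a unit
vector where `M` points in a nonnegative direction relative to `D`. -/
theorem exists_unit_inner_nonneg {E : Type*} [NormedAddCommGroup E] [InnerProductSpace ℝ E]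
    [FiniteDimensional ℝ E] [Nontrivial E] (D M : E →L[ℝ] E) (hD : ‖D‖ ≤ 1)
    (h : ∀ s : ℝ, 0 < s → 1 ≤ ‖D + s • M‖) :
    ∃ x : E, ‖x‖ = 1 ∧ 1 ≤ ‖D x‖ ∧ 0 ≤ ⟪D x, M x⟫ := by
  have hcpt : IsCompact (Metric.sphere (0 : E) 1) := isCompact_sphere 0 1
  have hex : ∀ s : ℝ, 0 < s → ∃ x ∈ Metric.sphere (0 : E) 1, 1 ≤ ‖D x + s • M x‖ := by
    intro s hs
    obtain ⟨x, hx, hmax⟩ := hcpt.exists_isMaxOn (NormedSpace.sphere_nonempty.2 zero_le_one)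
      (f := fun x => ‖(D + s • M) x‖) (by fun_prop)
    refine ⟨x, hx, (h s hs).trans ?_⟩
    exact ContinuousLinearMap.opNorm_le_of_unit_norm (norm_nonneg _)
      fun y hy => hmax (by simpa using hy)
  choose! f hf hf1 using hex
  have hpos : ∀ k : ℕ, 0 < 1 / ((k : ℝ) + 1) := fun k => by positivity
  obtain ⟨x, hx, φ, hφ, hlim⟩ := hcpt.tendsto_subseq fun k : ℕ => hf _ (hpos k)
  have hs : Filter.Tendsto (fun k => 1 / ((φ k : ℝ) + 1)) Filter.atTop (nhds 0) :=
    tendsto_one_div_add_atTop_nhds_zero_nat.comp hφ.tendsto_atTop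
  have hprod := hs.prodMk_nhds hlim
  refine ⟨x, by simpa using hx, ?_, ?_⟩
  · have hc : Continuous fun z : ℝ × E => ‖D z.2 + z.1 • M z.2‖ := by fun_prop
    have := ge_of_tendsto ((hc.tendsto (0, x)).comp hprod)
      (Filter.Eventually.of_forall fun k => hf1 _ (hpos (φ k)))
    simpa using this
  · have hc : Continuous fun z : ℝ × E => 2 * ⟪D z.2, M z.2⟫ + z.1 * ‖M z.2‖ ^ 2 := by fun_prop
    have := ge_of_tendsto (b := (0 : ℝ)) ((hc.tendsto (0, x)).comp hprod)
      (Filter.Eventually.of_forall fun k => ?_)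
    · simpa using this
    · have hk := hpos (φ k)
      have hk1 := hf1 _ hk
      have hk2 : ‖f (1 / ((φ k : ℝ) + 1))‖ = 1 := by simpa using hf _ hk
      simp only [Function.comp_apply]
      set s := 1 / ((φ k : ℝ) + 1)
      have hDx : ‖D (f s)‖ ≤ 1 := by simpa [hk2] using D.le_of_opNorm_le hD (f s)
      have hexp := norm_add_sq_real (D (f s)) (s • M (f s))
      rw [inner_smul_right, norm_smul, Real.norm_of_nonneg hk.le] at hexp
      have h1 : 1 ≤ ‖D (f s) + s • M (f s)‖ ^ 2 := one_le_pow₀ hk1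
      have h2 : ‖D (f s)‖ ^ 2 ≤ 1 := pow_le_one₀ (norm_nonneg _) hDx
      refine nonneg_of_mul_nonneg_right (a := s) ?_ hk
      nlinarith

theorem eps_mul_self {m n : ℕ} (a : Fin m → Fin n → ℝ) {i u : Fin n} (hu : u ∈ Sset a i) :
    eps a i u * eps a i u = 1 := by
  unfold eps
  split_ifs with h1 h2
  · norm_num
  · norm_num
  · exact absurd hu (by simp [Sset, h1, h2])

theorem sum_mul_eq_eps_mul {m n : ℕ} (a : Fin m → Fin n → ℝ) {i u : Fin n} (hu : u ∈ Sset a i)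
    (β : Fin m → ℝ) : ∑ k, β k * a k u = eps a i u * ∑ k, β k * a k i := by
  unfold eps
  split_ifs with h1 h2
  · rw [one_mul]
    exact Finset.sum_congr rfl fun k _ => by rw [show a k u = a k i from congrFun h1 k]
  · rw [neg_one_mul, ← Finset.sum_neg_distrib]
    exact Finset.sum_congr rfl fun k _ => by
      rw [show a k u = -a k i from congrFun h2 k, mul_neg]
  · exact absurd hu (by simp [Sset, h1, h2])

open Matrix in
open scoped RealInnerProductSpace in
theorem inner_sub_diagonal {m n : ℕ} (a : Fin m → Fin n → ℝ) (i : Fin n)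
    (T : Matrix (Fin n) (Fin n) ℝ) (β : Fin m → ℝ) (x y : EuclideanSpace ℝ (Fin n))
    (hx : ∀ h ∉ Sset a i, x h = 0) (hy : ∀ u, y u = eps a i u * x u) :
    ⟪y, toEuclideanLin (T - diagonal fun l => ∑ k, β k * a k l) x⟫ =
      (∑ u, ∑ v, eps a i u * T u v * x u * x v) - (∑ k, β k * a k i) * ‖x‖ ^ 2 := by
  rw [EuclideanSpace.real_norm_sq_eq, Finset.mul_sum, ← Finset.sum_sub_distrib,
    PiLp.inner_apply]
  refine Finset.sum_congr rfl fun u _ => ?_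
  have h1 : (toEuclideanLin (T - diagonal fun l => ∑ k, β k * a k l) x) u =
      ∑ v, T u v * x v - (∑ k, β k * a k u) * x u := by
    rw [toLpLin_apply, sub_mulVec]
    simp only [Pi.sub_apply, mulVec_diagonal]
    rfl
  have h2 : (∑ k, β k * a k u) * x u * (eps a i u * x u) = (∑ k, β k * a k i) * x u ^ 2 := by
    by_cases hu : u ∈ Sset a i
    · rw [sum_mul_eq_eps_mul a hu]
      linear_combination (∑ k, β k * a k i) * x u ^ 2 * eps_mul_self a hu
    · simp [hx u hu]
  rw [h1, hy, real_inner_eq_re_inner, ← h2]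
  simp only [RCLike.inner_apply, conj_trivial, RCLike.re_to_real, sub_mul, Finset.sum_mul]
  congr 1
  exact Finset.sum_congr rfl fun v _ => by ring

theorem norm_eq_of_eps_mul {m n : ℕ} (a : Fin m → Fin n → ℝ) (i : Fin n)
    (x y : EuclideanSpace ℝ (Fin n)) (hx : ∀ h ∉ Sset a i, x h = 0)
    (hy : ∀ u, y u = eps a i u * x u) : ‖y‖ = ‖x‖ := by
  rw [← sq_eq_sq₀ (norm_nonneg _) (norm_nonneg _), EuclideanSpace.real_norm_sq_eq,
    EuclideanSpace.real_norm_sq_eq]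
  refine Finset.sum_congr rfl fun u _ => ?_
  by_cases hu : u ∈ Sset a i
  · rw [hy]
    linear_combination x u ^ 2 * eps_mul_self a hu
  · rw [hy, hx u hu, mul_zero]

/-- `Wᵢ(T)` is an interval. -/
theorem mem_Wset_of_le_of_le {m n : ℕ} (a : Fin m → Fin n → ℝ) (i : Fin n)
    (T : Matrix (Fin n) (Fin n) ℝ) {c w₁ w₂ : ℝ} (h₁ : w₁ ∈ Wset a i T) (h₂ : w₂ ∈ Wset a i T)
    (hc₁ : w₁ ≤ c) (hc₂ : c ≤ w₂) : c ∈ Wset a i T := by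
  obtain ⟨x, hx, hxS, rfl⟩ := h₁
  obtain ⟨y, hy, hyS, rfl⟩ := h₂
  set q : EuclideanSpace ℝ (Fin n) → ℝ := fun z => ∑ u, ∑ v, eps a i u * T u v * z u * z v with hq
  have hsmul : ∀ (r : ℝ) z, q (r • z) = r ^ 2 * q z := by
    intro r z
    simp only [hq, Finset.mul_sum, PiLp.smul_apply, smul_eq_mul]
    exact Finset.sum_congr rfl fun u _ => Finset.sum_congr rfl fun v _ => by ring
  have hqc : Continuous q := by fun_prop
  let p : ℝ → EuclideanSpace ℝ (Fin n) := fun s => (1 - s) • x + s • y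
  have hp : Continuous p := by fun_prop
  obtain ⟨s, hs, hs0⟩ := intermediate_value_Icc (zero_le_one (α := ℝ))
    (f := fun s => q (p s) - c * ‖p s‖ ^ 2) (by fun_prop)
    (show (0 : ℝ) ∈ _ by simpa [p, hx, hy] using ⟨hc₁, hc₂⟩)
  by_cases hz : p s = 0
  · have hxy : (1 - s) • x = -(s • y) := eq_neg_of_add_eq_zero_left hz
    have hn := congrArg norm hxy
    rw [norm_neg, norm_smul, norm_smul, hx, hy, Real.norm_of_nonneg (sub_nonneg.2 hs.2),
      Real.norm_of_nonneg hs.1] at hn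
    have hs2 : s = 1 / 2 := by linarith
    have hqq := congrArg q hxy
    rw [← neg_smul, hsmul, hsmul, hs2] at hqq
    refine ⟨x, hx, hxS, le_antisymm ?_ hc₁⟩
    change c ≤ q x
    change c ≤ q y at hc₂
    linarith
  · have hnp : ‖p s‖ ≠ 0 := norm_ne_zero_iff.2 hz
    refine ⟨‖p s‖⁻¹ • p s, by rw [norm_smul, norm_inv, norm_norm, inv_mul_cancel₀ hnp], ?_, ?_⟩
    · intro h hh
      simp [p, hxS h hh, hyS h hh]
    · change c = q (‖p s‖⁻¹ • p s)
      have hs0 : q (p s) - c * ‖p s‖ ^ 2 = 0 := hs0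
      rw [hsmul, sub_eq_zero.1 hs0]
      field_simp

open Matrix in
open scoped RealInnerProductSpace in
theorem abs_sum_le_opNorm_of_mem_Wset {m n : ℕ} (a : Fin m → Fin n → ℝ) (i : Fin n)
    (T : Matrix (Fin n) (Fin n) ℝ) (α β : Fin m → ℝ)
    (h : ∑ k, α k * a k i ∈ Wset a i T) :
    |∑ k, (α k - β k) * a k i| ≤ opNorm (T - diagonal fun l => ∑ k, β k * a k l) := by
  obtain ⟨x, hx, hxS, hq⟩ := h
  let y : EuclideanSpace ℝ (Fin n) := WithLp.toLp 2 fun u => eps a i u * x u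
  have hy : ‖y‖ = 1 := (norm_eq_of_eps_mul a i x y hxS fun _ => rfl).trans hx
  have hin := inner_sub_diagonal a i T β x y hxS fun _ => rfl
  rw [← hq, hx, one_pow, mul_one, ← Finset.sum_sub_distrib] at hin
  simp only [sub_mul]
  rw [← hin]
  refine (abs_real_inner_le_norm _ _).trans ?_
  rw [hy, one_mul]
  simpa [hx, opNorm] using (LinearMap.toContinuousLinearMap
    (toEuclideanLin (T - diagonal fun l => ∑ k, β k * a k l))).le_opNorm x

/-- If a diagonal contraction whose entries have modulus less than one off `Sᵢ` attains norm one
at a unit vector, then that vector is supported in `Sᵢ`. -/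
theorem eq_zero_of_one_le_sum_sq {n : ℕ} {S : Set (Fin n)} {g : Fin n → ℝ}
    (hg : ∀ u, |g u| ≤ 1) (hgS : ∀ u ∉ S, |g u| < 1) {x : EuclideanSpace ℝ (Fin n)}
    (hx : ‖x‖ = 1) (h : 1 ≤ ∑ u, (g u * x u) ^ 2) : ∀ u ∉ S, x u = 0 := by
  intro u hu
  have hxs : ∑ u, x u ^ 2 = 1 := by rw [← EuclideanSpace.real_norm_sq_eq, hx, one_pow]
  have hle : ∀ v, (g v * x v) ^ 2 ≤ x v ^ 2 := fun v => by
    rw [mul_pow]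
    exact mul_le_of_le_one_left (sq_nonneg _) ((sq_le_one_iff_abs_le_one _).2 (hg v))
  have heq := (Finset.sum_eq_sum_iff_of_le fun v (_ : v ∈ Finset.univ) => hle v).1
    (le_antisymm (Finset.sum_le_sum fun v _ => hle v) (hxs.trans_le h)) u (Finset.mem_univ u)
  have hlt : g u ^ 2 < 1 := (sq_lt_one_iff_abs_lt_one _).2 (hgS u hu)
  have : (1 - g u ^ 2) * x u ^ 2 = 0 := by linear_combination -heq
  rcases mul_eq_zero.1 this with h0 | h0
  · linarith
  · exact pow_eq_zero_iff two_ne_zero |>.1 h0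

open Matrix in
open scoped RealInnerProductSpace in
theorem mem_Wset_of_forall_norm_le {m n : ℕ} (a : Fin m → Fin n → ℝ) (i : Fin n)
    (hi : StarProperty a i) (T : Matrix (Fin n) (Fin n) ℝ) (α : Fin m → ℝ)
    (h : ∀ β : Fin m → ℝ, ‖fun l => ∑ k, (α k - β k) * a k l‖ ≤
      opNorm (T - diagonal fun l => ∑ k, β k * a k l)) :
    ∑ k, α k * a k i ∈ Wset a i T := by
  obtain ⟨γ, hγ0, hγ⟩ := hi
  set g : Fin n → ℝ := fun l => (∑ k, γ k * a k l) / ∑ k, γ k * a k i with hg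
  have hgi : g i = 1 := div_self hγ0
  have hgout : ∀ u ∉ Sset a i, |g u| < 1 := fun u hu => by
    rw [hg, abs_div, div_lt_one (abs_pos.2 hγ0)]
    exact hγ u hu
  have hgin : ∀ u ∈ Sset a i, g u = eps a i u := fun u hu => by
    simp only [hg]
    rw [sum_mul_eq_eps_mul a hu, mul_div_cancel_right₀ _ hγ0]
  have hg1 : ∀ u, |g u| ≤ 1 := fun u => by
    by_cases hu : u ∈ Sset a i
    · rw [hgin u hu, ← sq_le_one_iff_abs_le_one, sq, eps_mul_self a hu]
    · exact (hgout u hu).le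
  set toCLM : Matrix (Fin n) (Fin n) ℝ →
    (EuclideanSpace ℝ (Fin n) →L[ℝ] EuclideanSpace ℝ (Fin n)) :=
    fun N => LinearMap.toContinuousLinearMap (toEuclideanLin N) with htoCLM
  set M : Matrix (Fin n) (Fin n) ℝ := T - diagonal fun l => ∑ k, α k * a k l with hM
  have hD : ‖toCLM (diagonal g)‖ ≤ 1 := by
    change opNorm (diagonal g) ≤ 1
    rw [opNorm_diagonal, pi_norm_le_iff_of_nonneg zero_le_one]
    exact hg1
  have hnorm : ∀ s : ℝ, s ≠ 0 → 1 ≤ ‖toCLM (diagonal g) + s • toCLM M‖ := by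
    intro s hs
    have hβ := h fun k => α k - s⁻¹ * (γ k / ∑ k, γ k * a k i)
    have hcoef : ∀ l, ∑ k, s⁻¹ * (γ k / ∑ k, γ k * a k i) * a k l = s⁻¹ * g l := by
      intro l
      simp only [hg, Finset.sum_div, Finset.mul_sum]
      exact Finset.sum_congr rfl fun k _ => by ring
    have hmat : (T - diagonal fun l => ∑ k, (α k - s⁻¹ * (γ k / ∑ k, γ k * a k i)) * a k l) =
        s⁻¹ • (diagonal g + s • M) := by
      have : (fun l => ∑ k, (α k - s⁻¹ * (γ k / ∑ k, γ k * a k i)) * a k l) =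
          (fun l => ∑ k, α k * a k l) - s⁻¹ • g := by
        ext l
        simp only [sub_mul, Finset.sum_sub_distrib, hcoef, Pi.sub_apply, Pi.smul_apply,
          smul_eq_mul]
      rw [this, smul_add, smul_smul, inv_mul_cancel₀ hs, one_smul, hM]
      ext u v
      rcases eq_or_ne u v with rfl | huv
      · simp only [Matrix.sub_apply, Matrix.add_apply, Matrix.smul_apply, diagonal_apply_eq,
          Pi.sub_apply, Pi.smul_apply, smul_eq_mul]
        ring
      · simp [huv]
    simp only [sub_sub_cancel, hcoef] at hβ
    rw [hmat] at hβ
    have hlow : |s⁻¹| ≤ ‖fun l => s⁻¹ * g l‖ := by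
      simpa [hgi] using norm_le_pi_norm (fun l => s⁻¹ * g l) i
    have hfac : opNorm (s⁻¹ • (diagonal g + s • M)) =
        |s⁻¹| * ‖toCLM (diagonal g) + s • toCLM M‖ := by
      rw [← Real.norm_eq_abs, ← norm_smul]
      simp [opNorm, htoCLM]
    rw [hfac] at hβ
    exact le_of_mul_le_mul_left (by simpa using hlow.trans hβ) (abs_pos.2 (inv_ne_zero hs))
  have hmem : ∀ x : EuclideanSpace ℝ (Fin n), ‖x‖ = 1 → 1 ≤ ‖toCLM (diagonal g) x‖ →
      (∀ u ∉ Sset a i, x u = 0) ∧ ⟪toCLM (diagonal g) x, toCLM M x⟫ =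
        (∑ u, ∑ v, eps a i u * T u v * x u * x v) - ∑ k, α k * a k i := by
    intro x hx hDx
    have happ : ∀ u, toCLM (diagonal g) x u = g u * x u := fun u => by
      simp [htoCLM, toLpLin_apply, mulVec_diagonal]
    have hS : ∀ u ∉ Sset a i, x u = 0 := by
      refine eq_zero_of_one_le_sum_sq hg1 hgout hx ?_
      have := one_le_pow₀ hDx (n := 2)
      rw [EuclideanSpace.real_norm_sq_eq] at this
      simpa only [happ] using this
    refine ⟨hS, ?_⟩
    have := inner_sub_diagonal a i T α x (toCLM (diagonal g) x) hS fun u => by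
      by_cases hu : u ∈ Sset a i
      · rw [happ, hgin u hu]
      · rw [happ, hS u hu, mul_zero, mul_zero]
    rw [hx, one_pow, mul_one] at this
    exact this
  have : Nonempty (Fin n) := ⟨i⟩
  obtain ⟨x, hx, hDx, hxin⟩ := exists_unit_inner_nonneg (toCLM (diagonal g)) (toCLM M) hD
    fun s hs => hnorm s hs.ne'
  obtain ⟨y, hy, hDy, hyin⟩ := exists_unit_inner_nonneg (toCLM (diagonal g)) (-toCLM M) hD
    fun s hs => by
      rw [show s • -toCLM M = (-s) • toCLM M by ext; simp]
      exact hnorm (-s) (neg_ne_zero.2 hs.ne')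
  obtain ⟨hxS, hxe⟩ := hmem x hx hDx
  obtain ⟨hyS, hye⟩ := hmem y hy hDy
  rw [_root_.neg_apply, inner_neg_right, hye] at hyin
  rw [hxe] at hxin
  exact mem_Wset_of_le_of_le a i T ⟨y, hy, hyS, rfl⟩ ⟨x, hx, hxS, rfl⟩ (by linarith) (by linarith)

open Matrix in
/-- Characterization of best coapproximations out of the span of simultaneously
diagonalizable matrices `A₁, …, A_m`, via the diagonal family `Dᵢ = PᵀAᵢQ`. -/
theorem best_coapprox_iff_mem_Wset_diagonalizable (m n : ℕ) (hm : 0 < m) (hn : 0 < n)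
    (A : Fin m → Matrix (Fin n) (Fin n) ℝ)
    (hA : LinearIndependent ℝ A)
    (hsymm₁ : ∀ i j, (A i * (A j)ᵀ).IsSymm)
    (hsymm₂ : ∀ i j, ((A i)ᵀ * A j).IsSymm)
    (P Q : Matrix (Fin n) (Fin n) ℝ)
    (hP₁ : Pᵀ * P = 1) (hP₂ : P * Pᵀ = 1) (hQ₁ : Qᵀ * Q = 1) (hQ₂ : Q * Qᵀ = 1)
    (d : Fin m → Fin n → ℝ)
    (hd : ∀ k, Pᵀ * A k * Q = Matrix.diagonal (d k))
    (r : ℕ) (j : Fin r → Fin n)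
    (hstar : ∀ p, StarProperty d (j p))
    (hnoneq : ∀ p q, p ≠ q → ¬ EquivComp d (j p) (j q))
    (hall : ∀ i : Fin n, StarProperty d i → ∃ p, EquivComp d i (j p))
    (T : Matrix (Fin n) (Fin n) ℝ) (α : Fin m → ℝ) :
    (∀ C ∈ Submodule.span ℝ (Set.range A),
        opNorm ((∑ k, α k • A k) - C) ≤ opNorm (T - C)) ↔
      ∀ p : Fin r, (∑ k, α k * d k (j p)) ∈ Wset d (j p) (Pᵀ * T * Q) := by
  have hcomb : ∀ β : Fin m → ℝ, Pᵀ * (∑ k, β k • A k) * Q =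
      diagonal fun l => ∑ k, β k * d k l := by
    intro β
    simp only [Matrix.mul_sum, Matrix.sum_mul, Matrix.mul_smul, Matrix.smul_mul, hd]
    ext u v
    rcases eq_or_ne u v with rfl | huv
    · simp [Matrix.sum_apply]
    · simp [Matrix.sum_apply, huv]
  have hleft : ∀ β : Fin m → ℝ, opNorm (∑ k, β k • A k) = ‖fun l => ∑ k, β k * d k l‖ := by
    intro β
    rw [← opNorm_transpose_mul_mul hP₁ hP₂ hQ₁ hQ₂, hcomb, opNorm_diagonal]
  have hright : ∀ β : Fin m → ℝ, opNorm (T - ∑ k, β k • A k) =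
      opNorm (Pᵀ * T * Q - diagonal fun l => ∑ k, β k * d k l) := by
    intro β
    rw [← opNorm_transpose_mul_mul hP₁ hP₂ hQ₁ hQ₂, Matrix.mul_sub, Matrix.sub_mul, hcomb]
  have hsub : ∀ β : Fin m → ℝ,
      ∑ k, α k • A k - ∑ k, β k • A k = ∑ k, (α k - β k) • A k := by
    intro β
    simp [sub_smul, Finset.sum_sub_distrib]
  have hspan : (∀ C ∈ Submodule.span ℝ (Set.range A),
        opNorm ((∑ k, α k • A k) - C) ≤ opNorm (T - C)) ↔
      ∀ β : Fin m → ℝ, ‖fun l => ∑ k, (α k - β k) * d k l‖ ≤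
        opNorm (Pᵀ * T * Q - diagonal fun l => ∑ k, β k * d k l) := by
    constructor
    · intro h β
      rw [← hleft, ← hright, ← hsub]
      exact h _ ((Submodule.mem_span_range_iff_exists_fun ℝ).2 ⟨β, rfl⟩)
    · intro h C hC
      obtain ⟨β, rfl⟩ := (Submodule.mem_span_range_iff_exists_fun ℝ).1 hC
      rw [hsub, hleft, hright]
      exact h β
  rw [hspan]
  constructor
  · intro h p
    exact mem_Wset_of_forall_norm_le d (j p) (hstar p) _ α h
  · intro h β
    refine (pi_norm_le_iff_of_nonneg (norm_nonneg _)).2 fun l => ?_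
    by_cases hl : ∑ k, (α k - β k) * d k l = 0
    · rw [hl, norm_zero]
      exact norm_nonneg _
    · obtain ⟨i, hi, hli⟩ := exists_starProperty_abs_le d (fun k => α k - β k) l hl
      obtain ⟨p, hp⟩ := hall i hi
      rw [Real.norm_eq_abs]
      refine hli.trans ?_
      have hpi : |∑ k, (α k - β k) * d k i| = |∑ k, (α k - β k) * d k (j p)| := by
        rcases hp with hp | hp
        · congr 1
          exact Finset.sum_congr rfl fun k _ => by rw [show d k (j p) = d k i from congrFun hp k]
        · rw [← abs_neg, ← Finset.sum_neg_distrib]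
          congr 1
          exact Finset.sum_congr rfl fun k _ => by
            rw [show d k (j p) = -d k i from congrFun hp k, mul_neg]
      rw [hpi]
      exact abs_sum_le_opNorm_of_mem_Wset d (j p) _ α β (h p)
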